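/- Suppose real numbers μ, a_1, …, a_14 are such that the 8 × 8 symmetric matrix G(μ, a_1, …, a_14) has rank at most 3, 0.6 ≤ μ ≤ 0.64759, and |a_j| < μ for all 1 ≤ j ≤ 14. Then a_3 = −a_8. -/

import Mathlib

/-- The `8 × 8` symmetric matrix `G(μ, a₁, …, a₁₄)` from the paper. -/
def packingGram (μ a1 a2 a3 a4 a5 a6 a7 a8 a9 a10 a11 a12 a13 a14 : ℝ) :
    Matrix (Fin 8) (Fin 8) ℝ :=
  !![1,  a1,  μ,  a2,  a3, -μ,  a4, -μ;
     a1, 1,  -μ,  a5, -μ,  a6, -μ,  a7;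
     μ, -μ,   1,   μ,  a8, -μ,  a9, a10;
     a2, a5,  μ,   1, a11, a12,  μ,   μ;
     a3, -μ, a8, a11,   1,   μ,  μ,  -μ;
     -μ, a6, -μ, a12,   μ,   1,  μ, a13;
     a4, -μ, a9,   μ,   μ,   μ,  1, a14;
     -μ, a7, a10,  μ,  -μ, a13, a14,  1]

theorem minor_zero (G : Matrix (Fin 8) (Fin 8) ℝ) (h : G.rank ≤ 3) (f g : Fin 4 → Fin 8) :
    (G.submatrix f g).det = 0 := by
  by_contra hd
  have h1 : (G.submatrix f g).rank = 4 := by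
    rw [Matrix.rank_of_isUnit _ ((Matrix.isUnit_iff_isUnit_det _).2 (isUnit_iff_ne_zero.2 hd))]
    simp
  have h2 := Matrix.rank_submatrix_le G f g
  omega

theorem det_four (A : Matrix (Fin 4) (Fin 4) ℝ) : A.det =
    A 0 0 * (A 1 1 * (A 2 2 * A 3 3 - A 2 3 * A 3 2) - A 1 2 * (A 2 1 * A 3 3 - A 2 3 * A 3 1)
      + A 1 3 * (A 2 1 * A 3 2 - A 2 2 * A 3 1))
    - A 0 1 * (A 1 0 * (A 2 2 * A 3 3 - A 2 3 * A 3 2) - A 1 2 * (A 2 0 * A 3 3 - A 2 3 * A 3 0)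
      + A 1 3 * (A 2 0 * A 3 2 - A 2 2 * A 3 0))
    + A 0 2 * (A 1 0 * (A 2 1 * A 3 3 - A 2 3 * A 3 1) - A 1 1 * (A 2 0 * A 3 3 - A 2 3 * A 3 0)
      + A 1 3 * (A 2 0 * A 3 1 - A 2 1 * A 3 0))
    - A 0 3 * (A 1 0 * (A 2 1 * A 3 2 - A 2 2 * A 3 1) - A 1 1 * (A 2 0 * A 3 2 - A 2 2 * A 3 0)
      + A 1 2 * (A 2 0 * A 3 1 - A 2 1 * A 3 0)) := by
  rw [Matrix.det_succ_row_zero]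
  simp only [Fin.sum_univ_four, Matrix.det_fin_three, Matrix.submatrix_apply]
  simp [Fin.succAbove, Fin.lt_def]
  ring

set_option maxHeartbeats 1000000 in
/-- **Step 7.** Under the rank-3 and coherence conditions on `G`, `a₃ = −a₈`. -/
theorem step7
    (μ a1 a2 a3 a4 a5 a6 a7 a8 a9 a10 a11 a12 a13 a14 : ℝ)
    (hrank : (packingGram μ a1 a2 a3 a4 a5 a6 a7 a8 a9 a10 a11 a12 a13 a14).rank ≤ 3)
    (hμ1 : (0.6 : ℝ) ≤ μ) (hμ2 : μ ≤ 0.64759)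
    (h1 : |a1| < μ) (h2 : |a2| < μ) (h3 : |a3| < μ) (h4 : |a4| < μ) (h5 : |a5| < μ)
    (h6 : |a6| < μ) (h7 : |a7| < μ) (h8 : |a8| < μ) (h9 : |a9| < μ) (h10 : |a10| < μ)
    (h11 : |a11| < μ) (h12 : |a12| < μ) (h13 : |a13| < μ) (h14 : |a14| < μ) :
    a3 = -a8 := by
  have minor := minor_zero _ hrank
  have hA := minor ![1, 4, 5, 6] ![1, 4, 5, 6]
  have hB := minor ![1, 2, 4, 5] ![1, 2, 4, 5]
  have hB' := minor ![1, 2, 5, 4] ![1, 2, 5, 6]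
  have hC := minor ![1, 2, 3, 6] ![1, 2, 3, 6]
  have hD := minor ![0, 2, 4, 5] ![0, 2, 4, 5]
  clear minor hrank
  rw [det_four] at hA hB hB' hC hD
  simp [packingGram] at hA hB hB' hC hD
  rw [abs_lt] at *
  have hA2 : (1 - μ) * (1 + a6) * ((1 + μ) * (1 - a6) - 4 * μ ^ 2) = 0 := by
    linear_combination hA
  have hB2 : (1 + a6 - 2 * μ ^ 2) * (1 - a6 - 2 * μ ^ 2) - (1 - a6 ^ 2) * a8 ^ 2 = 0 := by
    linear_combination hB
  have hB3 : (1 + a6 - 2 * μ ^ 2) * (μ * (1 - a6) - 2 * μ ^ 2) - (1 - a6 ^ 2) * (a8 * a9) = 0 := by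
    linear_combination hB'
  have hC2 : (1 - a9) * (1 + a5) * ((1 + a9) * (1 - a5) - 4 * μ ^ 2) = 0 := by
    linear_combination hC
  have hD2 : (1 - μ) * ((1 + 2 * μ) * (1 - μ - a3 ^ 2 - a8 ^ 2 - μ ^ 2)
      + μ * (a3 + a8 - μ) ^ 2) = 0 := by
    linear_combination hD
  clear hA hB hB' hC hD
  norm_num at hμ1 hμ2
  have n1 : 1 - μ ≠ 0 := by intro h; linarith
  have p1 : 0 < 1 + μ := by linarith
  have hA3 : (1 + μ) * (1 - a6) - 4 * μ ^ 2 = 0 := by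
    have : 1 + a6 ≠ 0 := by intro h; linarith [h6.1]
    simpa [n1, this] using hA2
  have hC3 : (1 + a9) * (1 - a5) - 4 * μ ^ 2 = 0 := by
    have t1 : 1 + a5 ≠ 0 := by intro h; linarith [h5.1]
    have t2 : 1 - a9 ≠ 0 := by intro h; linarith [h9.2]
    simpa [t1, t2] using hC2
  have hD3 : (1 + 2 * μ) * (1 - μ - a3 ^ 2 - a8 ^ 2 - μ ^ 2) + μ * (a3 + a8 - μ) ^ 2 = 0 := by
    simpa [n1] using hD2
  have ha6 : a6 = 1 - 4 * μ ^ 2 / (1 + μ) := by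
    field_simp; linear_combination -hA3
  have hμ0 : μ ≠ 0 := by intro h; linarith
  have hE : 2 * (1 + 2 * μ) * a8 ^ 2 = 1 + μ - 3 * μ ^ 2 - μ ^ 3 := by
    have hk : μ ^ 2 * (1 - μ) ≠ 0 := mul_ne_zero (pow_ne_zero _ hμ0) n1
    apply mul_left_cancel₀ hk
    rw [ha6] at hB2
    field_simp at hB2
    linear_combination (-1 / 4) * hB2
  have hE' : 2 * (1 + 2 * μ) * (a8 * a9) = -(1 + μ - 3 * μ ^ 2 - μ ^ 3) := by
    have hk : μ ^ 2 * (1 - μ) ≠ 0 := mul_ne_zero (pow_ne_zero _ hμ0) n1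
    apply mul_left_cancel₀ hk
    rw [ha6] at hB3
    field_simp at hB3
    linear_combination (-1 / 4) * hB3
  have hsq : (0.15 : ℝ) ^ 2 < a8 ^ 2 := by
    by_contra hcon
    push Not at hcon
    have : 1 + μ - 3 * μ ^ 2 - μ ^ 3 ≤ 2 * (1 + 2 * μ) * 0.15 ^ 2 := by
      rw [← hE]; exact mul_le_mul_of_nonneg_left hcon (by linarith)
    have q1 : μ ^ 2 ≤ 0.64759 ^ 2 := pow_le_pow_left₀ (by linarith) (by norm_num; exact hμ2) 2
    have q2 : μ ^ 3 ≤ 0.64759 ^ 3 := pow_le_pow_left₀ (by linarith) (by norm_num; exact hμ2) 3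
    have : 1 + μ - 3 * μ ^ 2 - μ ^ 3 > 2 * (1 + 2 * μ) * 0.15 ^ 2 := by
      nlinarith [mul_nonneg (sub_nonneg.2 hμ1) (sub_nonneg.2 hμ2)]
    linarith
  have h89 : a9 = -a8 := by
    have hk : 2 * (1 + 2 * μ) * a8 ≠ 0 := by
      apply mul_ne_zero
      · intro h; linarith
      · rintro rfl; norm_num at hsq
    apply mul_left_cancel₀ hk
    linear_combination hE' + hE
  have hneg : a8 < -0.15 := by
    rcases lt_or_ge a8 0 with h | h
    · by_contra h'
      have := mul_nonneg (show 0 ≤ a8 + 0.15 by linarith) (show 0 ≤ 0.15 - a8 by linarith)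
      linarith
    · exfalso
      have h15 : 0.15 < a8 := by
        by_contra h'
        have := mul_nonneg (show 0 ≤ a8 + 0.15 by linarith) (show 0 ≤ 0.15 - a8 by linarith)
        linarith
      rw [h89] at hC3
      have q1 := mul_pos (show 0 < 1 - a8 by linarith [h8.2]) (show 0 < μ + a5 by linarith [h5.1])
      have q2 := mul_pos (show 0 < a8 - 0.15 by linarith) p1
      have q3 := mul_nonneg (show 0 ≤ μ - 3 / 5 by linarith) (show 0 ≤ μ by linarith)
      linarith
  have hfac : (a3 + a8) * ((1 + μ) * a3 - (1 + 3 * μ) * a8 + 2 * μ ^ 2) = 0 := by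
    linear_combination -hD3 - hE
  rcases mul_eq_zero.1 hfac with h | h
  · linarith
  · exfalso
    have q1 := mul_pos p1 (show 0 < a3 + μ by linarith [h3.1])
    have q2 := mul_pos (show 0 < 1 + 3 * μ by linarith) (show 0 < -0.15 - a8 by linarith)
    have q3 := sq_nonneg (μ - 0.275)
    linarith
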